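/- arXiv:1510.08690 — 7 statements merged into one kernel-verified Lean document; each statement's English description precedes it below -/
import Mathlib

section
/- Let l ≥ 1 and k ≥ 1 be integers. For all complex numbers μ₁,…,μ_{l+1}, set ξ_a = e^{μ_a} + e^{−μ_a} for a = 1,…,l and define P(u) = P(u; μ₁,…,μ_{l+1}) = e^{k μ_{l+1}} ∏_{a=1}^{l} (u + ξ_a). Then for all complex numbers u ≠ v one has (1/k)·(∂P(u)/∂μ_{l+1})·(∂P(v)/∂μ_{l+1}) − ∑_{a=1}^{l} (∂P(u)/∂μ_a)·(∂P(v)/∂μ_a) = (k−l)·P(u)P(v) + ((u²−4)/(u−v))·(∂P(u)/∂u)·P(v) − ((v²−4)/(u−v))·P(u)·(∂P(v)/∂v), where all the partial derivatives with respect to μ_a are taken keeping u (respectively v) fixed. -/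
/-- The derivative of `w ↦ c * ∏ a, (w + x a)`. -/
theorem deriv_const_mul_prod_add {ι : Type*} [Fintype ι] [DecidableEq ι] (c : ℂ) (x : ι → ℂ)
    (u : ℂ) :
    deriv (fun w => c * ∏ a, (w + x a)) u =
      ∑ a, c * ∏ b ∈ Finset.univ.erase a, (u + x b) := by
  have h := (HasDerivAt.fun_finsetProd (u := Finset.univ) (f := fun a w => w + x a)
    (f' := fun _ => 1) (x := u) fun a _ => (hasDerivAt_id' u).add_const (x a)).const_mul c
  simpa [Finset.mul_sum] using h.deriv

/-- The derivative of `t ↦ w + (exp t + exp (-t))`, scaled by constants. -/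
theorem deriv_const_mul_add_exp_mul (c w q z : ℂ) :
    deriv (fun t => c * ((w + (Complex.exp t + Complex.exp (-t))) * q)) z =
      c * ((Complex.exp z - Complex.exp (-z)) * q) := by
  have h := (((((Complex.hasDerivAt_exp z).add (hasDerivAt_neg z).cexp).const_add w).mul_const
    q).const_mul c).deriv
  simpa [sub_eq_add_neg] using h

/-- The derivative of `t ↦ exp (k * t) * q`. -/
theorem deriv_exp_const_mul_mul (k q z : ℂ) :
    deriv (fun t => Complex.exp (k * t) * q) z = k * (Complex.exp (k * z) * q) := by
  have h := (((hasDerivAt_id' z).const_mul k).cexp.mul_const q).deriv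
  rw [h]
  ring

/-- The contribution of a single factor `u + ξ`, `ξ = e + f` with `e * f = 1`. -/
theorem single_factor_identity {u v : ℂ} (huv : u ≠ v) (c p q e f : ℂ) (hef : e * f = 1) :
    (c * ((e - f) * p)) * (c * ((e - f) * q)) =
      (c * ((u + (e + f)) * p)) * (c * ((v + (e + f)) * q)) -
        (u ^ 2 - 4) / (u - v) * (c * p) * (c * ((v + (e + f)) * q)) +
        (v ^ 2 - 4) / (u - v) * (c * ((u + (e + f)) * p)) * (c * q) := by
  have h : u - v ≠ 0 := sub_ne_zero.mpr huv
  field_simp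
  linear_combination (-4 * (u - v) * c ^ 2 * p * q) * hef

/-- Lemma 3.2 (first formula): the generating-function identity for the metric `g` on the
orbit space of the extended affine Weyl group of type `C_l`. Here
`P(u; μ) = e^{k μ_{l+1}} ∏_{a=1}^{l} (u + ξ_a)` with `ξ_a = e^{μ_a} + e^{-μ_a}`, and the
partial derivatives with respect to `μ_a` are taken keeping `u` (resp. `v`) fixed. -/
theorem stmt0 (l k : ℕ) (hl : 1 ≤ l) (hk : 1 ≤ k)
    (μ : Fin (l + 1) → ℂ) (u v : ℂ) (huv : u ≠ v) :
    let P : ℂ → (Fin (l + 1) → ℂ) → ℂ := fun w ν =>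
      Complex.exp ((k : ℂ) * ν (Fin.last l)) *
        ∏ a : Fin l, (w + (Complex.exp (ν a.castSucc) + Complex.exp (-ν a.castSucc)))
    let D : Fin (l + 1) → ((Fin (l + 1) → ℂ) → ℂ) → ((Fin (l + 1) → ℂ) → ℂ) :=
      fun i f ν => deriv (fun t => f (Function.update ν i t)) (ν i)
    (1 / (k : ℂ)) * D (Fin.last l) (P u) μ * D (Fin.last l) (P v) μ -
        ∑ a : Fin l, D a.castSucc (P u) μ * D a.castSucc (P v) μ =
      ((k : ℂ) - (l : ℂ)) * P u μ * P v μ +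
        ((u ^ 2 - 4) / (u - v)) * deriv (fun w => P w μ) u * P v μ -
        ((v ^ 2 - 4) / (u - v)) * P u μ * deriv (fun w => P w μ) v := by
  intro P D
  have hk0 : (k : ℂ) ≠ 0 := Nat.cast_ne_zero.mpr (by omega)
  set ξ : Fin l → ℂ := fun a => Complex.exp (μ a.castSucc) + Complex.exp (-μ a.castSucc)
  set c : ℂ := Complex.exp ((k : ℂ) * μ (Fin.last l))
  let Q : ℂ → Fin l → ℂ := fun w a => ∏ b ∈ Finset.univ.erase a, (w + ξ b)
  have hP (w : ℂ) (a : Fin l) : P w μ = c * ((w + ξ a) * Q w a) := by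
    simp only [P, Q]
    rw [Finset.mul_prod_erase Finset.univ (fun b => w + ξ b) (Finset.mem_univ a)]
  have hlast (w : ℂ) : D (Fin.last l) (P w) μ = k * P w μ := by
    simp only [D, P, Function.update_self,
      Function.update_of_ne (Fin.castSucc_ne_last _)]
    exact deriv_exp_const_mul_mul _ _ _
  have hD (w : ℂ) (a : Fin l) : D a.castSucc (P w) μ =
      c * ((Complex.exp (μ a.castSucc) - Complex.exp (-μ a.castSucc)) * Q w a) := by
    rw [← deriv_const_mul_add_exp_mul c w]
    simp only [D, P]
    congr 1
    funext t
    rw [Function.update_of_ne (Fin.castSucc_ne_last a).symm,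
      ← Finset.mul_prod_erase Finset.univ _ (Finset.mem_univ a), Function.update_self]
    congr 2
    refine Finset.prod_congr rfl fun b hb => ?_
    rw [Function.update_of_ne fun h =>
      Finset.ne_of_mem_erase hb (Fin.castSucc_injective l h)]
  have hu (w : ℂ) : deriv (fun w => P w μ) w = ∑ a, c * Q w a :=
    deriv_const_mul_prod_add c ξ w
  have hterm (a : Fin l) : D a.castSucc (P u) μ * D a.castSucc (P v) μ =
      P u μ * P v μ - (u ^ 2 - 4) / (u - v) * (c * Q u a) * P v μ +
        (v ^ 2 - 4) / (u - v) * P u μ * (c * Q v a) := by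
    rw [hD, hD, hP u a, hP v a]
    exact single_factor_identity huv c _ _ _ _ (by rw [← Complex.exp_add]; simp)
  have hsum : ∑ a : Fin l, D a.castSucc (P u) μ * D a.castSucc (P v) μ =
      l * (P u μ * P v μ) - (u ^ 2 - 4) / (u - v) * (∑ a, c * Q u a) * P v μ +
        (v ^ 2 - 4) / (u - v) * P u μ * ∑ a, c * Q v a := by
    rw [Finset.sum_congr rfl fun a _ => hterm a, Finset.sum_add_distrib,
      Finset.sum_sub_distrib, Finset.sum_const, Finset.card_univ, Fintype.card_fin,
      nsmul_eq_mul, Finset.mul_sum, Finset.sum_mul, Finset.mul_sum]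
  rw [hsum, hlast, hlast, hu, hu]
  generalize P u μ = p, P v μ = q, (∑ a, c * Q u a) = s, (∑ a, c * Q v a) = t
  have hkk : 1 / (k : ℂ) * (k * p) * (k * q) = k * p * q := by
    field_simp
  rw [hkk]
  ring
end

section
/- Let l ≥ 1 and k ≥ 1 be integers. For all complex numbers μ₁,…,μ_{l+1}, set ξ_a = e^{μ_a} + e^{−μ_a} for a = 1,…,l and define P(u) = e^{k μ_{l+1}} ∏_{a=1}^{l} (u + ξ_a). Then for all complex numbers u ≠ v and every index r ∈ {1,…,l+1} one has (1/k)·(∂P(u)/∂μ_{l+1})·(∂²P(v)/∂μ_r∂μ_{l+1}) − ∑_{a=1}^{l} (∂P(u)/∂μ_a)·(∂²P(v)/∂μ_r∂μ_a) = (k−l)·P(u)·∂P(v)/∂μ_r + ((u²−4)/(u−v))·(∂P(u)/∂u)·(∂P(v)/∂μ_r) − ((v²−4)/(u−v))·P(u)·(∂²P(v)/∂μ_r∂v) + ((uv−4)/(u−v)²)·( P(v)·∂P(u)/∂μ_r − P(u)·∂P(v)/∂μ_r ). -/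
/-- The partial derivative of `f` in the `i`-th coordinate. -/
noncomputable def coordDeriv {n : ℕ} (i : Fin n) (f : (Fin n → ℂ) → ℂ) (ν : Fin n → ℂ) : ℂ :=
  deriv (fun t => f (Function.update ν i t)) (ν i)

/-- The product `e^{k ν_{l+1}} ∏_{a ∈ s} (w + ξ_a)`. -/
noncomputable def partialProd {l : ℕ} (k : ℕ) (w : ℂ) (s : Finset (Fin l))
    (ν : Fin (l + 1) → ℂ) : ℂ :=
  Complex.exp ((k : ℂ) * ν (Fin.last l)) *
    ∏ a ∈ s, (w + (Complex.exp (ν a.castSucc) + Complex.exp (-ν a.castSucc)))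

section

variable {l : ℕ} (k : ℕ) (w : ℂ) (s : Finset (Fin l)) (ν : Fin (l + 1) → ℂ)

theorem partialProd_eq_mul_erase {c : Fin l} (hc : c ∈ s) :
    partialProd k w s ν =
      (w + (Complex.exp (ν c.castSucc) + Complex.exp (-ν c.castSucc))) *
        partialProd k w (s.erase c) ν := by
  rw [partialProd, partialProd, ← Finset.mul_prod_erase s _ hc]
  ring

theorem partialProd_update_castSucc {c : Fin l} (hc : c ∉ s) (t : ℂ) :
    partialProd k w s (Function.update ν c.castSucc t) = partialProd k w s ν := by
  unfold partialProd
  rw [Function.update_of_ne (Fin.castSucc_ne_last c).symm]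
  congr 1
  refine Finset.prod_congr rfl fun a ha => ?_
  have hac : a.castSucc ≠ c.castSucc := fun h => hc (Fin.castSucc_injective l h ▸ ha)
  rw [Function.update_of_ne hac]

theorem hasDerivAt_partialProd_last (x : ℂ) :
    HasDerivAt (fun t => partialProd k w s (Function.update ν (Fin.last l) t))
      (k * partialProd k w s (Function.update ν (Fin.last l) x)) x := by
  have h : ∀ t, partialProd k w s (Function.update ν (Fin.last l) t) =
      Complex.exp (k * t) *
        ∏ a ∈ s, (w + (Complex.exp (ν a.castSucc) + Complex.exp (-ν a.castSucc))) := by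
    intro t
    simp [partialProd]
  simp only [h]
  have h1 := (((hasDerivAt_id x).const_mul (k : ℂ)).cexp).mul_const
    (∏ a ∈ s, (w + (Complex.exp (ν a.castSucc) + Complex.exp (-ν a.castSucc))))
  refine h1.congr_deriv ?_
  simp only [id]
  ring

theorem hasDerivAt_partialProd_castSucc {c : Fin l} (hc : c ∈ s) (x : ℂ) :
    HasDerivAt (fun t => partialProd k w s (Function.update ν c.castSucc t))
      ((Complex.exp x - Complex.exp (-x)) * partialProd k w (s.erase c) ν) x := by
  have h : ∀ t, partialProd k w s (Function.update ν c.castSucc t) =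
      (w + (Complex.exp t + Complex.exp (-t))) * partialProd k w (s.erase c) ν := by
    intro t
    rw [partialProd_eq_mul_erase k w s _ hc,
      partialProd_update_castSucc k w _ ν (Finset.notMem_erase c s)]
    simp
  simp only [h]
  refine HasDerivAt.mul_const ?_ _
  refine (((Complex.hasDerivAt_exp x).add (hasDerivAt_neg x).cexp).const_add w).congr_deriv ?_
  ring

theorem coordDeriv_last_partialProd :
    coordDeriv (Fin.last l) (partialProd k w s) ν = k * partialProd k w s ν := by
  simpa [coordDeriv] using (hasDerivAt_partialProd_last k w s ν (ν (Fin.last l))).deriv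

theorem coordDeriv_castSucc_partialProd {c : Fin l} (hc : c ∈ s) :
    coordDeriv c.castSucc (partialProd k w s) ν =
      (Complex.exp (ν c.castSucc) - Complex.exp (-ν c.castSucc)) *
        partialProd k w (s.erase c) ν :=
  (hasDerivAt_partialProd_castSucc k w s ν hc (ν c.castSucc)).deriv

theorem differentiable_partialProd_update (i : Fin (l + 1)) :
    Differentiable ℂ fun t => partialProd k w s (Function.update ν i t) := by
  have hu : ∀ j, Differentiable ℂ fun t : ℂ => Function.update ν i t j := fun j => by
    rcases eq_or_ne j i with rfl | h
    · simp
    · simp [Function.update_of_ne h]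
  unfold partialProd
  fun_prop

theorem deriv_partialProd :
    deriv (fun z => partialProd k z s ν) w = ∑ a ∈ s, partialProd k w (s.erase a) ν := by
  unfold partialProd
  rw [deriv_const_mul_field, deriv_fun_finsetProd (fun i _ => by fun_prop), Finset.mul_sum]
  simp

theorem coordDeriv_const_mul (i : Fin (l + 1)) (b : ℂ) (f : (Fin (l + 1) → ℂ) → ℂ) :
    coordDeriv i (fun x => b * f x) ν = b * coordDeriv i f ν :=
  deriv_const_mul_field _

theorem coordDeriv_sum_partialProd (i : Fin (l + 1)) :
    coordDeriv i (fun x => ∑ a ∈ s, partialProd k w (s.erase a) x) ν =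
      ∑ a ∈ s, coordDeriv i (partialProd k w (s.erase a)) ν :=
  deriv_fun_sum fun _ _ => (differentiable_partialProd_update k w _ ν i).differentiableAt

theorem coordDeriv_castSucc_partialProd_of_notMem {c : Fin l} (hc : c ∉ s) :
    coordDeriv c.castSucc (partialProd k w s) ν = 0 := by
  simp [coordDeriv, partialProd_update_castSucc k w s ν hc]

/-- Differentiating a function of a single other coordinate times `partialProd`. -/
theorem coordDeriv_mul_partialProd_of_ne {i j : Fin (l + 1)} (hij : j ≠ i) (g : ℂ → ℂ) :
    coordDeriv i (fun x => g (x j) * partialProd k w s x) ν =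
      g (ν j) * coordDeriv i (partialProd k w s) ν := by
  simp [coordDeriv, Function.update_of_ne hij]

theorem coordDeriv_castSucc_coordDeriv_self {c : Fin l} :
    coordDeriv c.castSucc (fun x => (Complex.exp (x c.castSucc) - Complex.exp (-x c.castSucc)) *
        partialProd k w (s.erase c) x) ν =
      (Complex.exp (ν c.castSucc) + Complex.exp (-ν c.castSucc)) *
        partialProd k w (s.erase c) ν := by
  simp only [coordDeriv, partialProd_update_castSucc k w _ ν (Finset.notMem_erase c s),
    Function.update_self]
  rw [deriv_mul_const_field]
  congr 1
  refine (((Complex.hasDerivAt_exp _).sub (hasDerivAt_neg _).cexp).congr_deriv ?_).deriv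
  ring

end

theorem sum_sq_sub_four_mul {ι : Type*} (s : Finset ι) (x A B : ι → ℂ) {u v U V : ℂ}
    (huv : u ≠ v) (hU : ∀ a ∈ s, U = (u + x a) * A a) (hV : ∀ a ∈ s, V = (v + x a) * B a) :
    ∑ a ∈ s, (x a ^ 2 - 4) * (A a * B a) =
      s.card * (U * V) - (u ^ 2 - 4) / (u - v) * (∑ a ∈ s, A a) * V +
        (v ^ 2 - 4) / (u - v) * U * ∑ a ∈ s, B a := by
  have h : u - v ≠ 0 := sub_ne_zero.2 huv
  rw [← nsmul_eq_mul, ← Finset.sum_const, Finset.mul_sum, Finset.mul_sum, Finset.sum_mul,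
    ← Finset.sum_sub_distrib, ← Finset.sum_add_distrib]
  refine Finset.sum_congr rfl fun a ha => ?_
  have e1 : (x a ^ 2 - 4) * (A a * B a) = (u + x a) * A a * ((v + x a) * B a) -
      (u ^ 2 - 4) / (u - v) * A a * ((v + x a) * B a) +
        (v ^ 2 - 4) / (u - v) * ((u + x a) * A a) * B a := by
    field_simp
    ring
  rw [e1, ← hU a ha, ← hV a ha]

theorem exp_sub_exp_neg_sq (z : ℂ) :
    (Complex.exp z - Complex.exp (-z)) ^ 2 = (Complex.exp z + Complex.exp (-z)) ^ 2 - 4 := by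
  have h : Complex.exp z * Complex.exp (-z) = 1 := by rw [← Complex.exp_add]; simp
  linear_combination (-4) * h

/-- Lemma 3.2 (second formula): the generating-function identity for the contravariant
Christoffel symbols of the metric `g` on the orbit space of the extended affine Weyl group of
type `C_l`. Here `P(u; μ) = e^{k μ_{l+1}} ∏_{a=1}^{l} (u + ξ_a)` with
`ξ_a = e^{μ_a} + e^{-μ_a}`, and partial derivatives with respect to the `μ`'s are taken
keeping `u` (resp. `v`) fixed. -/
theorem stmt1 (l k : ℕ) (hl : 1 ≤ l) (hk : 1 ≤ k)
    (μ : Fin (l + 1) → ℂ) (u v : ℂ) (huv : u ≠ v) (r : Fin (l + 1)) :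
    let P : ℂ → (Fin (l + 1) → ℂ) → ℂ := fun w ν =>
      Complex.exp ((k : ℂ) * ν (Fin.last l)) *
        ∏ a : Fin l, (w + (Complex.exp (ν a.castSucc) + Complex.exp (-ν a.castSucc)))
    let D : Fin (l + 1) → ((Fin (l + 1) → ℂ) → ℂ) → ((Fin (l + 1) → ℂ) → ℂ) :=
      fun i f ν => deriv (fun t => f (Function.update ν i t)) (ν i)
    (1 / (k : ℂ)) * D (Fin.last l) (P u) μ * D r (D (Fin.last l) (P v)) μ -
        ∑ a : Fin l, D a.castSucc (P u) μ * D r (D a.castSucc (P v)) μ =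
      ((k : ℂ) - (l : ℂ)) * P u μ * D r (P v) μ +
        ((u ^ 2 - 4) / (u - v)) * deriv (fun w => P w μ) u * D r (P v) μ -
        ((v ^ 2 - 4) / (u - v)) * P u μ * D r (fun ν => deriv (fun w => P w ν) v) μ +
        ((u * v - 4) / (u - v) ^ 2) * (P v μ * D r (P u) μ - P u μ * D r (P v) μ) := by
  intro P D
  have hP : P = fun w => partialProd k w Finset.univ := rfl
  have hD : D = coordDeriv := rfl
  have hk0 : (k : ℂ) ≠ 0 := Nat.cast_ne_zero.2 (by omega)
  have h : u - v ≠ 0 := sub_ne_zero.2 huv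
  clear_value P D
  subst hP hD
  have hlast : coordDeriv (Fin.last l) (partialProd k v Finset.univ) =
      fun x => k * partialProd k v Finset.univ x :=
    funext fun x => coordDeriv_last_partialProd k v _ x
  have hcast : ∀ a : Fin l, coordDeriv a.castSucc (partialProd k v Finset.univ) =
      fun x => (Complex.exp (x a.castSucc) - Complex.exp (-x a.castSucc)) *
        partialProd k v (Finset.univ.erase a) x :=
    fun a => funext fun x => coordDeriv_castSucc_partialProd k v _ x (Finset.mem_univ a)
  simp only [deriv_partialProd, coordDeriv_sum_partialProd]
  simp only [hlast, coordDeriv_const_mul, coordDeriv_last_partialProd,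
    fun a : Fin l => coordDeriv_castSucc_partialProd k u _ μ (Finset.mem_univ a)]
  induction r using Fin.lastCases with
  | last =>
    have key := sum_sq_sub_four_mul Finset.univ
      (fun a : Fin l => Complex.exp (μ a.castSucc) + Complex.exp (-μ a.castSucc))
      (fun a => partialProd k u (Finset.univ.erase a) μ)
      (fun a => partialProd k v (Finset.univ.erase a) μ) huv
      (fun a ha => partialProd_eq_mul_erase k u _ μ ha)
      (fun a ha => partialProd_eq_mul_erase k v _ μ ha)
    have hsum : ∑ a : Fin l, (Complex.exp (μ a.castSucc) - Complex.exp (-μ a.castSucc)) *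
          partialProd k u (Finset.univ.erase a) μ *
          coordDeriv (Fin.last l) (coordDeriv a.castSucc (partialProd k v Finset.univ)) μ =
        k * ∑ a : Fin l, ((Complex.exp (μ a.castSucc) + Complex.exp (-μ a.castSucc)) ^ 2 - 4) *
          (partialProd k u (Finset.univ.erase a) μ *
            partialProd k v (Finset.univ.erase a) μ) := by
      rw [Finset.mul_sum]
      refine Finset.sum_congr rfl fun a _ => ?_
      rw [hcast, coordDeriv_mul_partialProd_of_ne k v _ μ (Fin.castSucc_ne_last a)
        (fun z => Complex.exp z - Complex.exp (-z)), coordDeriv_last_partialProd,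
        ← exp_sub_exp_neg_sq]
      ring
    rw [hsum, key]
    simp only [coordDeriv_last_partialProd, ← Finset.mul_sum, Finset.card_univ, Fintype.card_fin]
    field_simp
    ring
  | cast c =>
    have key := sum_sq_sub_four_mul (Finset.univ.erase c)
      (fun a : Fin l => Complex.exp (μ a.castSucc) + Complex.exp (-μ a.castSucc))
      (fun a => partialProd k u (Finset.univ.erase a) μ)
      (fun a => partialProd k v ((Finset.univ.erase c).erase a) μ) huv
      (fun a _ => partialProd_eq_mul_erase k u _ μ (Finset.mem_univ a))
      (fun a ha => partialProd_eq_mul_erase k v _ μ ha)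
    have hcard : ((Finset.univ.erase c).card : ℂ) = l - 1 := by
      rw [Finset.card_erase_of_mem (Finset.mem_univ c), Finset.card_univ, Fintype.card_fin,
        Nat.cast_sub hl, Nat.cast_one]
    rw [hcard] at key
    have hsum : ∑ a ∈ Finset.univ.erase c,
          (Complex.exp (μ a.castSucc) - Complex.exp (-μ a.castSucc)) *
          partialProd k u (Finset.univ.erase a) μ *
          coordDeriv c.castSucc (coordDeriv a.castSucc (partialProd k v Finset.univ)) μ =
        (Complex.exp (μ c.castSucc) - Complex.exp (-μ c.castSucc)) *
        ∑ a ∈ Finset.univ.erase c,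
          ((Complex.exp (μ a.castSucc) + Complex.exp (-μ a.castSucc)) ^ 2 - 4) *
          (partialProd k u (Finset.univ.erase a) μ *
            partialProd k v ((Finset.univ.erase c).erase a) μ) := by
      rw [Finset.mul_sum]
      refine Finset.sum_congr rfl fun a ha => ?_
      have hac : a ≠ c := Finset.ne_of_mem_erase ha
      rw [hcast, coordDeriv_mul_partialProd_of_ne k v _ μ
        (fun e => hac (Fin.castSucc_injective l e)) (fun z => Complex.exp z - Complex.exp (-z)),
        coordDeriv_castSucc_partialProd k v _ μ
          (Finset.mem_erase.2 ⟨hac.symm, Finset.mem_univ c⟩),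
        ← exp_sub_exp_neg_sq, Finset.erase_right_comm]
      ring
    have hmixed : ∑ a : Fin l, coordDeriv c.castSucc (partialProd k v (Finset.univ.erase a)) μ =
        (Complex.exp (μ c.castSucc) - Complex.exp (-μ c.castSucc)) *
          ∑ a ∈ Finset.univ.erase c, partialProd k v ((Finset.univ.erase c).erase a) μ := by
      rw [← Finset.add_sum_erase _ _ (Finset.mem_univ c),
        coordDeriv_castSucc_partialProd_of_notMem k v _ μ (Finset.notMem_erase c _), zero_add,
        Finset.mul_sum]
      refine Finset.sum_congr rfl fun a ha => ?_
      rw [coordDeriv_castSucc_partialProd k v _ μ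
        (Finset.mem_erase.2 ⟨(Finset.ne_of_mem_erase ha).symm, Finset.mem_univ c⟩),
        Finset.erase_right_comm]
    rw [hmixed, ← Finset.add_sum_erase _ _ (Finset.mem_univ c), hsum, key,
      ← Finset.add_sum_erase _ (fun a => partialProd k u (Finset.univ.erase a) μ)
        (Finset.mem_univ c)]
    simp only [hcast, coordDeriv_castSucc_coordDeriv_self,
      coordDeriv_castSucc_partialProd k u _ μ (Finset.mem_univ c),
      partialProd_eq_mul_erase k u _ μ (Finset.mem_univ c),
      partialProd_eq_mul_erase k v _ μ (Finset.mem_univ c)]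
    field_simp
    ring
end

section
/- Let k ≥ 1 and l be integers. A nonzero polynomial p ∈ ℂ[u] satisfies the identity (k−l)·(u−v)·p(u)p(v) + (u²−4)·p′(u)p(v) − (v²−4)·p(u)p′(v) = 0 in ℂ[u,v] if and only if l ≥ k and there exist a nonzero complex number a and an integer m with 0 ≤ m ≤ l−k such that p(u) = a·(u+2)^m·(u−2)^{l−k−m}. -/
open Polynomial

theorem X_sub_C_mul_derivative_pow {R : Type*} [CommRing R] (r : R) (m : ℕ) :
    (X - C r) * derivative ((X - C r) ^ m) = C (m : R) * (X - C r) ^ m := by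
  cases m with
  | zero => simp
  | succ m => rw [derivative_X_sub_C_pow, Nat.add_sub_cancel]; ring

theorem mul_derivative_X_sub_C_pow_mul_pow {R : Type*} [CommRing R] (r s a : R) (m n : ℕ) :
    (X - C r) * (X - C s) * derivative (C a * (X - C r) ^ m * (X - C s) ^ n) =
      (C (m : R) * (X - C s) + C (n : R) * (X - C r)) *
        (C a * (X - C r) ^ m * (X - C s) ^ n) := by
  simp only [derivative_mul, derivative_C, zero_mul, zero_add]
  linear_combination
    (X - C s) * C a * (X - C s) ^ n * X_sub_C_mul_derivative_pow r m +
    (X - C r) * C a * (X - C r) ^ m * X_sub_C_mul_derivative_pow s n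

/-- The nonzero polynomials whose logarithmic derivative is `α / (X - r) + β / (X - s)`. -/
theorem exists_eq_X_sub_C_pow_mul_pow_of_mul_derivative_eq {K : Type*} [Field K] [CharZero K]
    {r s : K} (hrs : r ≠ s) (p : K[X]) (hp : p ≠ 0) (α β : K)
    (h : (X - C r) * (X - C s) * derivative p =
      (C α * (X - C s) + C β * (X - C r)) * p) :
    ∃ a : K, a ≠ 0 ∧ ∃ m n : ℕ, α = m ∧ β = n ∧
      p = C a * (X - C r) ^ m * (X - C s) ^ n := by
  induction hd : p.natDegree generalizing p α β with
  | zero =>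
    obtain ⟨a, rfl⟩ : ∃ a, p = C a := ⟨_, eq_C_of_natDegree_eq_zero hd⟩
    have ha : a ≠ 0 := by simpa using hp
    have hα := congrArg (eval r) h
    have hβ := congrArg (eval s) h
    simp [ha, sub_eq_zero, hrs, hrs.symm] at hα hβ
    exact ⟨a, ha, 0, 0, by simpa using hα, by simpa using hβ, by simp⟩
  | succ d ih =>
    by_cases hr : p.IsRoot r
    · obtain ⟨q, rfl⟩ := dvd_iff_isRoot.mpr hr
      have hq : q ≠ 0 := right_ne_zero_of_mul hp
      obtain ⟨a, ha, m, n, hm, hn, rfl⟩ := ih q hq (α - 1) β (by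
        apply mul_left_cancel₀ (X_sub_C_ne_zero r)
        simp only [derivative_mul, derivative_X_sub_C] at h
        simp only [C_sub, C_1]
        linear_combination h) (by
        rw [natDegree_mul (X_sub_C_ne_zero r) hq, natDegree_X_sub_C] at hd
        omega)
      exact ⟨a, ha, m + 1, n, by push_cast; linear_combination hm, hn, by ring⟩
    by_cases hs : p.IsRoot s
    · obtain ⟨q, rfl⟩ := dvd_iff_isRoot.mpr hs
      have hq : q ≠ 0 := right_ne_zero_of_mul hp
      obtain ⟨a, ha, m, n, hm, hn, rfl⟩ := ih q hq α (β - 1) (by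
        apply mul_left_cancel₀ (X_sub_C_ne_zero s)
        simp only [derivative_mul, derivative_X_sub_C] at h
        simp only [C_sub, C_1]
        linear_combination h) (by
        rw [natDegree_mul (X_sub_C_ne_zero s) hq, natDegree_X_sub_C] at hd
        omega)
      exact ⟨a, ha, m, n + 1, hm, by push_cast; linear_combination hn, by ring⟩
    have hα := congrArg (eval r) h
    have hβ := congrArg (eval s) h
    rw [IsRoot.def] at hr hs
    simp [hr, hs, sub_eq_zero, hrs, hrs.symm] at hα hβ
    subst hα hβ
    have h0 : derivative p = 0 := by
      simpa [X_sub_C_ne_zero] using h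
    rw [derivative_eq_zero.mp h0] at hd
    omega

/-- Equation (3.20) of the paper (multiplied through by `(u-v)`): a nonzero polynomial
`p ∈ ℂ[u]` satisfies `(k-l)(u-v)p(u)p(v) + (u²-4)p'(u)p(v) - (v²-4)p(u)p'(v) = 0`
iff `l ≥ k` and `p(u) = a (u+2)^m (u-2)^{l-k-m}` for some `a ≠ 0` and `0 ≤ m ≤ l-k`
(here encoded by `m + n = l - k` with exponent `n = l - k - m`). -/
theorem stmt2 (k l : ℤ) (hk : 1 ≤ k) (p : Polynomial ℂ) (hp : p ≠ 0) :
    (∀ u v : ℂ,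
        ((k : ℂ) - (l : ℂ)) * (u - v) * p.eval u * p.eval v +
            (u ^ 2 - 4) * p.derivative.eval u * p.eval v -
            (v ^ 2 - 4) * p.eval u * p.derivative.eval v = 0) ↔
      k ≤ l ∧ ∃ a : ℂ, a ≠ 0 ∧ ∃ m n : ℕ, (m : ℤ) + (n : ℤ) = l - k ∧
        p = Polynomial.C a * (X + 2) ^ m * (X - 2) ^ n := by
  have hX : (X + 2 : ℂ[X]) = X - C (-2) := by
    rw [C_neg, sub_neg_eq_add]; rfl
  have hX' : (X - 2 : ℂ[X]) = X - C 2 := rfl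
  rw [hX, hX']
  constructor
  · intro h
    obtain ⟨v, hv⟩ : ∃ v, p.eval v ≠ 0 := by
      by_contra! hzero
      exact hp (Polynomial.funext fun x => by simpa using hzero x)
    set c : ℂ := (v ^ 2 - 4) * p.derivative.eval v / p.eval v - (l - k) * v with hc
    have hcv : c * p.eval v = (v ^ 2 - 4) * p.derivative.eval v - (l - k) * v * p.eval v := by
      rw [hc]; field_simp
    obtain ⟨a, ha, m, n, hm, hn, hpeq⟩ :=
      exists_eq_X_sub_C_pow_mul_pow_of_mul_derivative_eq (r := -2) (s := 2) (by norm_num) p hp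
        ((l - k) / 2 - c / 4) ((l - k) / 2 + c / 4) (by
          refine Polynomial.funext fun u => mul_right_cancel₀ hv ?_
          simp only [eval_mul, eval_add, eval_sub, eval_X, eval_C]
          linear_combination h u v - p.eval u * hcv)
    have hmn : (m : ℤ) + n = l - k := by
      have : (m : ℂ) + n = l - k := by linear_combination -hm - hn
      exact_mod_cast this
    exact ⟨by omega, a, ha, m, n, hmn, hpeq⟩
  · rintro ⟨-, a, -, m, n, hmn, hpeq⟩ u v
    have hmn' : (m : ℂ) + n = l - k := by exact_mod_cast hmn
    have key (w : ℂ) :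
        (w + 2) * (w - 2) * p.derivative.eval w = (m * (w - 2) + n * (w + 2)) * p.eval w := by
      have := congrArg (eval w) (mul_derivative_X_sub_C_pow_mul_pow (-2 : ℂ) 2 a m n)
      rw [← hpeq] at this
      simpa only [eval_mul, eval_add, eval_sub, eval_X, eval_C, sub_neg_eq_add] using this
    linear_combination p.eval v * key u - p.eval u * key v + (u - v) * p.eval u * p.eval v * hmn'
end

section
/- For an integer i ≥ 1, define f_i : (0,∞) → ℝ by f_i(t) = cosh(√t/2) · (2 sinh(√t/2)/√t)^{2i−1}. Then for all integers i, j ≥ 1 and all t > 0, the function t ↦ t^{i+j−1} f_i(t) f_j(t) is differentiable on (0,∞) and 4(i+j−1)·t^{i+j−2}·f_{i+j−1}(t) + (i+j)·t^{i+j−1}·f_{i+j}(t) = 4·(d/dt)( t^{i+j−1} f_i(t) f_j(t) ). -/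
theorem hasDerivAt_cosh_sq_mul_two_sinh_pow (m : ℕ) {t : ℝ} (ht : 0 < t) :
    HasDerivAt (fun s => Real.cosh (√s / 2) ^ 2 * (2 * Real.sinh (√s / 2)) ^ (2 * m + 2))
      (Real.cosh (√t / 2) * (2 * Real.sinh (√t / 2)) ^ (2 * m + 1) *
        (4 * (m + 1) + (m + 2) * (2 * Real.sinh (√t / 2)) ^ 2) / (4 * √t)) t := by
  have hu : HasDerivAt (fun s => √s / 2) (1 / (2 * √t) / 2) t :=
    (Real.hasDerivAt_sqrt ht.ne').div_const 2
  have hr : √t ≠ 0 := (Real.sqrt_pos.2 ht).ne'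
  refine ((hu.cosh.pow 2).mul ((hu.sinh.const_mul 2).pow (2 * m + 2))).congr_deriv ?_
  have hc := Real.cosh_sq (√t / 2)
  rw [show 2 * m + 2 - 1 = 2 * m + 1 by omega]
  simp only [Pi.pow_apply]
  push_cast
  field_simp
  rw [hc]
  ring

theorem pow_mul_mul_div_sqrt_pow (a b : ℕ) (c x : ℝ) {s : ℝ} (hs : 0 < s) :
    s ^ (a + b + 1) * (c * (x / √s) ^ (2 * a + 1)) * (c * (x / √s) ^ (2 * b + 1)) =
      c ^ 2 * x ^ (2 * (a + b) + 2) := by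
  have hr : √s ≠ 0 := (Real.sqrt_pos.2 hs).ne'
  calc
    _ = c ^ 2 * (s * (x / √s) ^ 2) ^ (a + b + 1) := by ring
    _ = c ^ 2 * (x ^ 2) ^ (a + b + 1) := by
      rw [div_pow, Real.sq_sqrt hs.le, mul_div_cancel₀ _ hs.ne']
    _ = _ := by ring

theorem pow_mul_div_sqrt_pow (m : ℕ) (x : ℝ) {s : ℝ} (hs : 0 < s) :
    s ^ m * (x / √s) ^ (2 * m + 1) = x ^ (2 * m + 1) / √s := by
  calc
    _ = (s * (x / √s) ^ 2) ^ m * (x / √s) := by ring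
    _ = (x ^ 2) ^ m * (x / √s) := by
      rw [div_pow, Real.sq_sqrt hs.le, mul_div_cancel₀ _ hs.ne']
    _ = _ := by ring


/-- Verification from the proof of Lemma 3.4 of the paper: the functions
`f_i(t) = cosh(√t/2) (2 sinh(√t/2)/√t)^{2i-1}` (for `i ≥ 1`) satisfy, for all `t > 0`,
`4(i+j-1) t^{i+j-2} f_{i+j-1}(t) + (i+j) t^{i+j-1} f_{i+j}(t) = 4 d/dt (t^{i+j-1} f_i f_j)`,
the function `t ↦ t^{i+j-1} f_i(t) f_j(t)` being differentiable on `(0,∞)`. -/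
theorem stmt5 (f : ℕ → ℝ → ℝ)
    (hf : ∀ i, 1 ≤ i → ∀ t : ℝ, f i t =
      Real.cosh (Real.sqrt t / 2) *
        (2 * Real.sinh (Real.sqrt t / 2) / Real.sqrt t) ^ (2 * i - 1))
    (i j : ℕ) (hi : 1 ≤ i) (hj : 1 ≤ j) (t : ℝ) (ht : 0 < t) :
    DifferentiableAt ℝ (fun s => s ^ (i + j - 1) * f i s * f j s) t ∧
      (4 * (i + j - 1) : ℕ) * t ^ (i + j - 2) * f (i + j - 1) t +
          ((i + j : ℕ) : ℝ) * t ^ (i + j - 1) * f (i + j) t =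
        4 * deriv (fun s => s ^ (i + j - 1) * f i s * f j s) t := by
  obtain ⟨a, rfl⟩ := Nat.exists_eq_add_of_le' hi
  obtain ⟨b, rfl⟩ := Nat.exists_eq_add_of_le' hj
  have hd : HasDerivAt (fun s => s ^ (a + 1 + (b + 1) - 1) * f (a + 1) s * f (b + 1) s) _ t :=
    (hasDerivAt_cosh_sq_mul_two_sinh_pow (a + b) ht).congr_of_eventuallyEq <| by
      filter_upwards [lt_mem_nhds ht] with s hs
      rw [hf _ hi, hf _ hj, ← pow_mul_mul_div_sqrt_pow a b _ _ hs]
      congr 3; omega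
  refine ⟨hd.differentiableAt, ?_⟩
  rw [hd.deriv, hf _ (by omega), hf _ (by omega),
    show a + 1 + (b + 1) - 1 = a + b + 1 by omega, show a + 1 + (b + 1) - 2 = a + b by omega,
    show 2 * (a + b + 1) - 1 = 2 * (a + b) + 1 by omega,
    show 2 * (a + 1 + (b + 1)) - 1 = 2 * (a + b + 1) + 1 by omega]
  have h₀ := pow_mul_div_sqrt_pow (a + b) (2 * Real.sinh (√t / 2)) ht
  have h₁ := pow_mul_div_sqrt_pow (a + b + 1) (2 * Real.sinh (√t / 2)) ht
  push_cast
  linear_combination 4 * (a + b + 1) * Real.cosh (√t / 2) * h₀ +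
    (a + b + 2) * Real.cosh (√t / 2) * h₁
end

section
/- Let l, k, m be integers with 1 ≤ k ≤ l and 1 ≤ m ≤ l−k−1. Define rational numbers d̃₁,…,d̃_{l+1} by: d̃_j = j/k for 1 ≤ j ≤ k; d̃_s = (2l−2m−2s+1)/(2(l−m−k)) for k+1 ≤ s ≤ l−m; d̃_α = (2l−2α+1)/(2m) for l−m+1 ≤ α ≤ l; and d̃_{l+1} = 0. Define a map * on {1,…,l+1} by: j* = k−j for 1 ≤ j ≤ k−1; k* = l+1; (l+1)* = k; s* = l−m+k+1−s for k+1 ≤ s ≤ l−m; α* = 2l−m+1−α for l−m+1 ≤ α ≤ l. Then * is a well-defined involution of {1,…,l+1} and d̃_i + d̃_{i*} = 1 for every i ∈ {1,…,l+1}. -/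
/-- The duality relation (3.56)-(3.57) of the paper: the degrees `d̃₁,…,d̃_{l+1}` of the flat
coordinates of the metric `η` on the orbit space of `W̃^{(k)}(C_l)` satisfy
`d̃_i + d̃_{i*} = 1`, where `*` is the involution of `{1,…,l+1}` obtained by reflecting each
component of the Dynkin diagram of `C_l` with the `k`-th vertex deleted (the chain
`k+1,…,l` being further split at the vertex `l-m`), extended by `k* = l+1`, `(l+1)* = k`.
The hypothesis `1 ≤ m ≤ l-k-1` is encoded as `1 ≤ m` and `m + k + 1 ≤ l`. -/
theorem stmt8 (l k m : ℕ) (hk : 1 ≤ k) (hkl : k ≤ l) (hm : 1 ≤ m) (hml : m + k + 1 ≤ l) :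
    let d : ℕ → ℚ := fun i =>
      if i ≤ k then (i : ℚ) / k
      else if i ≤ l - m then
        (2 * (l : ℚ) - 2 * m - 2 * i + 1) / (2 * ((l : ℚ) - m - k))
      else if i ≤ l then (2 * (l : ℚ) - 2 * i + 1) / (2 * m)
      else 0
    let star : ℕ → ℕ := fun i =>
      if i ≤ k - 1 then k - i
      else if i = k then l + 1
      else if i ≤ l - m then l - m + k + 1 - i
      else if i ≤ l then 2 * l - m + 1 - i
      else k
    (∀ i, 1 ≤ i → i ≤ l + 1 → 1 ≤ star i ∧ star i ≤ l + 1 ∧ star (star i) = i) ∧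
      ∀ i, 1 ≤ i → i ≤ l + 1 → d i + d (star i) = 1 := by
  intro d star
  refine ⟨fun i h₁ h₂ => by grind, fun i h₁ h₂ => ?_⟩
  obtain ⟨n, rfl⟩ := Nat.exists_eq_add_of_le hml
  have hk₀ : (k : ℚ) ≠ 0 := by positivity
  have hm₀ : (m : ℚ) ≠ 0 := by positivity
  have hn₀ : (n : ℚ) + 1 ≠ 0 := by positivity
  have hden : ((m + k + 1 + n : ℕ) : ℚ) - m - k = n + 1 := by push_cast; ring
  rcases lt_trichotomy i k with hi | rfl | hi
  · have hs : star i = k - i := by grind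
    have hd : d i = (i : ℚ) / k := by grind
    have hd' : d (k - i) = ((k - i : ℕ) : ℚ) / k := by grind
    rw [hs, hd, hd', Nat.cast_sub hi.le]
    field_simp
    ring
  · have hs : star i = m + i + 1 + n + 1 := by grind
    have hd : d i = (i : ℚ) / i := by grind
    have hd' : d (m + i + 1 + n + 1) = 0 := by grind
    rw [hs, hd, hd', div_self hk₀, add_zero]
  · by_cases hi' : i ≤ k + 1 + n
    · obtain ⟨j, hj⟩ : ∃ j, i + j = 2 * k + n + 2 := ⟨2 * k + n + 2 - i, by lia⟩
      have hs : star i = j := by grind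
      have hval (x : ℕ) (hx : k < x) (hx' : x ≤ k + 1 + n) :
          d x = (2 * ((k : ℚ) + 1 + n) - 2 * x + 1) / (2 * (n + 1)) := by
        simp only [d]
        rw [if_neg (by lia), if_pos (by lia), hden]
        push_cast
        ring
      have hjq : (j : ℚ) = 2 * k + n + 2 - i := by
        rw [eq_sub_iff_add_eq', ← Nat.cast_add, hj]; push_cast; ring
      rw [hs, hval i hi hi', hval j (by lia) (by lia), hjq]
      field_simp
      ring
    · rcases h₂.lt_or_eq with hi'' | rfl
      · obtain ⟨j, hj⟩ : ∃ j, i + j = m + 2 * k + 2 * n + 3 :=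
          ⟨m + 2 * k + 2 * n + 3 - i, by lia⟩
        have hs : star i = j := by grind
        have hval (x : ℕ) (hx : k + 1 + n < x) (hx' : x ≤ m + k + 1 + n) :
            d x = (2 * ((m : ℚ) + k + 1 + n) - 2 * x + 1) / (2 * m) := by
          simp only [d]
          rw [if_neg (by lia), if_neg (by lia), if_pos (by lia)]
          push_cast
          ring
        have hjq : (j : ℚ) = m + 2 * k + 2 * n + 3 - i := by
          rw [eq_sub_iff_add_eq', ← Nat.cast_add, hj]; push_cast; ring
        rw [hs, hval i (by lia) (by lia), hval j (by lia) (by lia), hjq]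
        field_simp
        ring
      · have hs : star (m + k + 1 + n + 1) = k := by grind
        have hd : d (m + k + 1 + n + 1) = 0 := by grind
        have hd' : d k = (k : ℚ) / k := by grind
        rw [hs, hd, hd', div_self hk₀, zero_add]
end

section
/- Fix integers k ≥ 1 and m, n ≥ 0, set l = k+m+n, fix a nonzero complex number a₀ and pairwise distinct complex numbers b₁,…,b_l, none equal to 0 or 1. Define λ : ℂ∖{0,1} → ℂ by λ(z) = a₀ · (z−1)^{−m} · z^{−n} · ∏_{j=1}^{l} (z − b_j). Suppose c₁,…,c_{l+1} are pairwise distinct complex numbers, none belonging to {0,1,b₁,…,b_l}, such that for all z ∈ ℂ∖{0,1} one has λ′(z) = k a₀ · (z−1)^{−m−1} · z^{−n−1} · ∏_{α=1}^{l+1} (z − c_α). Then λ″(c_α) ≠ 0 for every α, and for all β, γ ∈ {1,…,l}: ∑_{α=1}^{l+1} λ(c_α) / ( λ″(c_α) · c_α (c_α − 1)(c_α − b_β)(c_α − b_γ) ) = −δ_{βγ} / ( b_β (b_β − 1) ), where δ_{βγ} is the Kronecker delta. -/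
open Polynomial in
/-- At a root of `N`, only the derivative of `N` contributes to the derivative of
`a (z - 1) ^ p z ^ q N(z)`. -/
theorem deriv_zpow_mul_eval_of_isRoot (a : ℂ) (p q : ℤ) (N : ℂ[X]) {x : ℂ} (hx0 : x ≠ 0)
    (hx1 : x ≠ 1) (hx : N.eval x = 0) :
    deriv (fun z : ℂ => a * (z - 1) ^ p * z ^ q * N.eval z) x =
      a * (x - 1) ^ p * x ^ q * N.derivative.eval x := by
  have hx1' : x - 1 ≠ 0 := sub_ne_zero.mpr hx1
  have hf : DifferentiableAt ℂ (fun z : ℂ => a * (z - 1) ^ p * z ^ q) x := by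
    have h1 : DifferentiableAt ℂ (fun z : ℂ => (z - 1) ^ p) x :=
      DifferentiableAt.zpow (by fun_prop) (Or.inl hx1')
    have h0 : DifferentiableAt ℂ (fun z : ℂ => z ^ q) x :=
      DifferentiableAt.zpow (by fun_prop) (Or.inl hx0)
    exact (h1.const_mul a).mul h0
  rw [deriv_fun_mul hf N.differentiableAt, hx, mul_zero, zero_add, N.deriv]

open Polynomial Lagrange in
/-- Partial fraction expansion of `P / nodal univ c` for `P` of degree less than the number of
nodes. -/
theorem sum_eval_div_eval_derivative_nodal {F ι : Type*} [Field F] [Fintype ι] [DecidableEq ι]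
    {c : ι → F} (hc : Function.Injective c) {P : F[X]} (hP : P.degree < Fintype.card ι)
    {x : F} (hx : ∀ i, x ≠ c i) :
    ∑ i, P.eval (c i) / ((nodal Finset.univ c).derivative.eval (c i) * (x - c i)) =
      P.eval x / (nodal Finset.univ c).eval x := by
  have hne : (nodal Finset.univ c).eval x ≠ 0 := eval_nodal_not_at_node fun i _ => hx i
  rw [eq_div_iff hne, mul_comm]
  conv_rhs => rw [eq_interpolate (s := Finset.univ) (f := P) hc.injOn (by simpa using hP),
    eval_interpolate_not_at_node _ fun i _ => hx i]
  congr 1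
  refine Finset.sum_congr rfl fun i hi => ?_
  rw [nodalWeight_eq_eval_derivative_nodal hi, div_eq_mul_inv, mul_inv]
  ring

/-- The residue-theorem identity from the proof of Lemma 5.4 of the paper (formula (5.15)),
in the variable `z = cos²φ`: for `λ(z) = a₀ (z-1)^{-m} z^{-n} ∏_{j=1}^{l}(z - b_j)` with
`λ'(z) = k a₀ (z-1)^{-m-1} z^{-n-1} ∏_{α=1}^{l+1}(z - c_α)`, one has `λ''(c_α) ≠ 0` and
`∑_{α} λ(c_α)/(λ''(c_α) c_α (c_α-1)(c_α-b_β)(c_α-b_γ)) = -δ_{βγ}/(b_β(b_β-1))`. -/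
theorem stmt14 (k m n : ℕ) (hk : 1 ≤ k) (a₀ : ℂ) (ha : a₀ ≠ 0)
    (b : Fin (k + m + n) → ℂ) (hb : Function.Injective b)
    (hb0 : ∀ j, b j ≠ 0) (hb1 : ∀ j, b j ≠ 1)
    (lam : ℂ → ℂ)
    (hlam : ∀ z : ℂ, lam z = a₀ * (z - 1) ^ (-(m : ℤ)) * z ^ (-(n : ℤ)) * ∏ j, (z - b j))
    (c : Fin (k + m + n + 1) → ℂ) (hc : Function.Injective c)
    (hc0 : ∀ α, c α ≠ 0) (hc1 : ∀ α, c α ≠ 1) (hcb : ∀ α j, c α ≠ b j)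
    (hfact : ∀ z : ℂ, z ≠ 0 → z ≠ 1 →
      deriv lam z = (k : ℂ) * a₀ * (z - 1) ^ (-((m : ℤ) + 1)) * z ^ (-((n : ℤ) + 1)) *
        ∏ α, (z - c α)) :
    (∀ α, deriv (deriv lam) (c α) ≠ 0) ∧
      ∀ β γ : Fin (k + m + n),
        ∑ α, lam (c α) /
            (deriv (deriv lam) (c α) * c α * (c α - 1) * (c α - b β) * (c α - b γ)) =
          -(if β = γ then (1 : ℂ) else 0) / (b β * (b β - 1)) := by
  classical
  set B := Lagrange.nodal Finset.univ b with hB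
  set C := Lagrange.nodal Finset.univ c with hC
  have hk0 : (k : ℂ) ≠ 0 := by exact_mod_cast (by omega : k ≠ 0)
  have hlam' : lam = fun z : ℂ => a₀ * (z - 1) ^ (-(m : ℤ)) * z ^ (-(n : ℤ)) * B.eval z := by
    funext z
    rw [hlam, hB, Lagrange.eval_nodal]
  have hfact' : ∀ z : ℂ, z ≠ 0 → z ≠ 1 → deriv lam z =
      (k : ℂ) * a₀ * (z - 1) ^ (-((m : ℤ) + 1)) * z ^ (-((n : ℤ) + 1)) * C.eval z := by
    intro z h0 h1
    rw [hfact z h0 h1, hC, Lagrange.eval_nodal]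
  have hsecond : ∀ α, deriv (deriv lam) (c α) =
      k * a₀ * (c α - 1) ^ (-((m : ℤ) + 1)) * (c α) ^ (-((n : ℤ) + 1)) *
        C.derivative.eval (c α) := by
    intro α
    rw [← deriv_zpow_mul_eval_of_isRoot _ _ _ C (hc0 α) (hc1 α)
      (Lagrange.eval_nodal_at_node (Finset.mem_univ α))]
    apply Filter.EventuallyEq.deriv_eq
    filter_upwards [isOpen_ne.mem_nhds (hc0 α), isOpen_ne.mem_nhds (hc1 α)] with z h0 h1
    exact hfact' z h0 h1
  have hC' : ∀ α, C.derivative.eval (c α) ≠ 0 := by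
    intro α
    rw [hC, Lagrange.eval_nodal_derivative_eval_node_eq (Finset.mem_univ α)]
    exact Lagrange.eval_nodal_not_at_node fun i hi => hc.ne (Finset.ne_of_mem_erase hi).symm
  have hc1' : ∀ α, c α - 1 ≠ 0 := fun α => sub_ne_zero.mpr (hc1 α)
  have hCb : ∀ γ, k * C.eval (b γ) = b γ * (b γ - 1) * B.derivative.eval (b γ) := by
    intro γ
    have h0 := hb0 γ
    have h1 : b γ - 1 ≠ 0 := sub_ne_zero.mpr (hb1 γ)
    have h := hfact' (b γ) h0 (hb1 γ)
    rw [hlam', deriv_zpow_mul_eval_of_isRoot _ _ _ B h0 (hb1 γ)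
      (Lagrange.eval_nodal_at_node (Finset.mem_univ γ))] at h
    simp only [neg_add, zpow_add₀ h0, zpow_add₀ h1, zpow_neg, zpow_natCast, zpow_one] at h
    field_simp at h
    linear_combination -h
  refine ⟨fun α => ?_, fun β γ => ?_⟩
  · rw [hsecond]
    have := zpow_ne_zero (-((m : ℤ) + 1)) (hc1' α)
    have := zpow_ne_zero (-((n : ℤ) + 1)) (hc0 α)
    have := hC' α
    positivity
  set P := Lagrange.nodal (Finset.univ.erase β) b with hP
  have hterm : ∀ α, lam (c α) /
      (deriv (deriv lam) (c α) * c α * (c α - 1) * (c α - b β) * (c α - b γ)) =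
      -(k : ℂ)⁻¹ * (P.eval (c α) / (C.derivative.eval (c α) * (b γ - c α))) := by
    intro α
    have h0 := hc0 α
    have h1 := hc1' α
    have hβ : c α - b β ≠ 0 := sub_ne_zero.mpr (hcb α β)
    have hγ : c α - b γ ≠ 0 := sub_ne_zero.mpr (hcb α γ)
    have hγ' : b γ - c α ≠ 0 := sub_ne_zero.mpr (hcb α γ).symm
    have hD := hC' α
    have hBP : B.eval (c α) = (c α - b β) * P.eval (c α) := by
      rw [hB, Lagrange.nodal_eq_mul_nodal_erase (Finset.mem_univ β)]
      simp [hP]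
    rw [hsecond, hlam']
    simp only [neg_add, zpow_add₀ h0, zpow_add₀ h1, zpow_neg, zpow_natCast, zpow_one, hBP]
    field_simp
    ring
  have hdeg : P.degree < Fintype.card (Fin (k + m + n + 1)) := by
    rw [hP, Lagrange.degree_nodal, Finset.card_erase_of_mem (Finset.mem_univ β)]
    simp only [Finset.card_univ, Fintype.card_fin]
    exact_mod_cast (by omega : k + m + n - 1 < k + m + n + 1)
  rw [Finset.sum_congr rfl fun α _ => hterm α, ← Finset.mul_sum,
    sum_eval_div_eval_derivative_nodal hc hdeg fun α => (hcb α γ).symm]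
  split_ifs with h
  · subst h
    have hCne : C.eval (b β) ≠ 0 :=
      Lagrange.eval_nodal_not_at_node fun α _ => (hcb α β).symm
    have hBP : B.derivative.eval (b β) = P.eval (b β) :=
      Lagrange.eval_nodal_derivative_eval_node_eq (Finset.mem_univ β)
    have h0 := hb0 β
    have h1 : b β - 1 ≠ 0 := sub_ne_zero.mpr (hb1 β)
    have h2 := hCb β
    rw [hBP] at h2
    rw [← hC]
    field_simp
    linear_combination h2
  · have : P.eval (b γ) = 0 :=
      Lagrange.eval_nodal_at_node (Finset.mem_erase.mpr ⟨Ne.symm h, Finset.mem_univ γ⟩)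
    simp [this]
end

section
/- Fix integers k ≥ 1 and n ≥ 0, set l = k+n, fix a nonzero complex number a₀ and complex numbers p₁,…,p_l with p₁²,…,p_l² pairwise distinct and none equal to 0 or 1, and define λ(φ) = a₀ · cos(φ)^{−2n} · ∏_{j=1}^{l} (cos²φ − p_j²) on the open set where cos(φ) ≠ 0. Then λ′(0) = 0, λ(0) ≠ 0, and λ″(0)/λ(0) = −2·( k + ∑_{s=1}^{l} p_s²/(1 − p_s²) ). -/
open Filter Topology in
/-- First two derivatives at `0` of `φ ↦ g (cos² φ)`, for `g` analytic at `1`. -/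
theorem deriv_comp_cos_sq_zero {g : ℂ → ℂ} (hg : AnalyticAt ℂ g 1) :
    deriv (fun φ => g (Complex.cos φ ^ 2)) 0 = 0 ∧
      deriv (deriv fun φ => g (Complex.cos φ ^ 2)) 0 = -2 * deriv g 1 := by
  have hcos (φ : ℂ) : HasDerivAt (fun φ => Complex.cos φ ^ 2)
      (-2 * Complex.cos φ * Complex.sin φ) φ :=
    ((Complex.hasDerivAt_cos φ).pow 2).congr_deriv (by push_cast; ring)
  have htend : Tendsto (fun φ => Complex.cos φ ^ 2) (𝓝 0) (𝓝 1) := by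
    simpa using (hcos 0).continuousAt.tendsto
  have hev : deriv (fun φ => g (Complex.cos φ ^ 2)) =ᶠ[𝓝 0]
      fun φ => deriv g (Complex.cos φ ^ 2) * (-2 * Complex.cos φ * Complex.sin φ) := by
    filter_upwards [htend.eventually hg.eventually_analyticAt] with φ hφ
    exact (hφ.differentiableAt.hasDerivAt.comp φ (hcos φ)).deriv
  refine ⟨by simpa using hev.eq_of_nhds, ?_⟩
  rw [hev.deriv_eq]
  have hd : DifferentiableAt ℂ (deriv g) (Complex.cos 0 ^ 2) := by
    simpa using hg.deriv.differentiableAt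
  have h := (hd.hasDerivAt.comp 0 (hcos 0)).mul
    (((Complex.hasDerivAt_cos 0).const_mul (-2)).mul (Complex.hasDerivAt_sin 0))
  exact (h.congr_deriv (by simp [mul_comm])).deriv


/-- Lemma 5.5 of the paper (formula (5.17)) in the case `m = 0`: for the superpotential
`λ(φ) = a₀ cos^{-2n}(φ) ∏_{j=1}^{l}(cos²φ - p_j²)` (with `l = k+n`), the point `φ = 0` is
critical, `λ(0) ≠ 0`, and `λ''(0)/λ(0) = -2(k + ∑_s p_s²/(1-p_s²))`. -/
theorem stmt16 (k n : ℕ) (hk : 1 ≤ k) (a₀ : ℂ) (ha : a₀ ≠ 0)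
    (p : Fin (k + n) → ℂ) (hp : Function.Injective fun j => p j ^ 2)
    (hp0 : ∀ j, p j ^ 2 ≠ 0) (hp1 : ∀ j, p j ^ 2 ≠ 1)
    (lam : ℂ → ℂ)
    (hlam : ∀ φ : ℂ, lam φ =
      a₀ * Complex.cos φ ^ (-(2 * n : ℤ)) * ∏ s, (Complex.cos φ ^ 2 - p s ^ 2)) :
    deriv lam 0 = 0 ∧ lam 0 ≠ 0 ∧
      deriv (deriv lam) 0 / lam 0 =
        -2 * ((k : ℂ) + ∑ s, p s ^ 2 / (1 - p s ^ 2)) := by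
  set g : ℂ → ℂ := fun x => a₀ * x ^ (-(n : ℤ)) * ∏ s, (x - p s ^ 2) with hgdef
  have hlam' : lam = fun φ => g (Complex.cos φ ^ 2) := by
    funext φ
    have hpow : Complex.cos φ ^ (-(2 * n : ℤ)) = (Complex.cos φ ^ 2) ^ (-(n : ℤ)) := by
      rw [← zpow_natCast, ← zpow_mul]
      congr 1
      push_cast
      ring
    rw [hlam, hpow]
  have hsub (s) : (1 : ℂ) - p s ^ 2 ≠ 0 := sub_ne_zero.mpr (hp1 s).symm
  have hg1 : g 1 ≠ 0 := by
    simp [hgdef, ha, Finset.prod_ne_zero_iff, hsub]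
  have hpow : AnalyticAt ℂ (fun x : ℂ => x ^ (-(n : ℤ))) 1 :=
    analyticAt_id.zpow one_ne_zero
  have hprod : AnalyticAt ℂ (fun x : ℂ => ∏ s, (x - p s ^ 2)) 1 :=
    Finset.analyticAt_fun_prod _ fun s _ => analyticAt_id.sub analyticAt_const
  have hg : AnalyticAt ℂ g 1 := (analyticAt_const.mul hpow).mul hprod
  have hlog : logDeriv g 1 = k + ∑ s, p s ^ 2 / (1 - p s ^ 2) := by
    rw [hgdef, logDeriv_mul (f := fun x => a₀ * x ^ (-(n : ℤ))) 1 (by simpa using ha)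
      (Finset.prod_ne_zero_iff.mpr fun s _ => hsub s)
      (analyticAt_const.mul hpow).differentiableAt hprod.differentiableAt,
      logDeriv_const_mul 1 a₀ ha, logDeriv_prod (fun s _ => hsub s)
        (fun s _ => by fun_prop), logDeriv_zpow]
    have hterm (s) : logDeriv (fun x => x - p s ^ 2) 1 = 1 + p s ^ 2 / (1 - p s ^ 2) := by
      have := hsub s
      simp only [logDeriv_apply, deriv_sub_const, deriv_id'']
      field_simp
      ring
    simp only [hterm, Finset.sum_add_distrib]
    simp
    ring
  obtain ⟨h1, h2⟩ := deriv_comp_cos_sq_zero hg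
  have h0 : lam 0 = g 1 := by simp [hlam']
  refine ⟨hlam' ▸ h1, h0 ▸ hg1, ?_⟩
  rw [h0, hlam', h2, mul_div_assoc, ← logDeriv_apply, hlog]
end
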